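/- Let A = kQ/I be a (locally) gentle algebra. Then GKdim(A) = 1 if A is locally gentle (infinite dimensional), and GKdim(A) = 0 if A is gentle (finite dimensional). -/

import Mathlib

/- Common framework for (locally) gentle algebras -/

noncomputable section
open scoped BigOperators
open CategoryTheory

namespace LocGentle

/-- A finite connected quiver with at least one vertex and one arrow. -/
structure Quiv where
  V : Type
  Arr : Type
  [fintypeV : Fintype V]
  [fintypeA : Fintype Arr]
  [decEqV : DecidableEq V]
  [decEqA : DecidableEq Arr]
  src : Arr → V
  tgt : Arr → V
  [nonemptyV : Nonempty V]
  [nonemptyA : Nonempty Arr]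
  connected : (SimpleGraph.fromRel (fun v w => ∃ a, src a = v ∧ tgt a = w)).Connected

attribute [instance] Quiv.fintypeV Quiv.fintypeA Quiv.decEqV Quiv.decEqA
  Quiv.nonemptyV Quiv.nonemptyA

variable (Q : Quiv)

/-- in-degree of a vertex -/
def indeg (v : Q.V) : ℕ := (Finset.univ.filter (fun a => Q.tgt a = v)).card

/-- out-degree of a vertex -/
def outdeg (v : Q.V) : ℕ := (Finset.univ.filter (fun a => Q.src a = v)).card

/-- a list of arrows is composable (forms a path) -/
def Composable (l : List Q.Arr) : Prop := l.Chain' (fun a b => Q.tgt a = Q.src b)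

variable {Q}

/-- source vertex of a nonempty word -/
def wSrc? (l : List Q.Arr) : Option Q.V := l.head?.map Q.src

/-- target vertex of a nonempty word -/
def wTgt? (l : List Q.Arr) : Option Q.V := l.getLast?.map Q.tgt

/-- target of a word, with a default value (used for stationary paths) -/
def wTgtD (l : List Q.Arr) (v : Q.V) : Q.V := (l.getLast?.map Q.tgt).getD v

/-- last arrow of a word, with a (junk) default -/
def wLast (l : List Q.Arr) : Q.Arr := l.getLast?.getD (Classical.arbitrary _)

variable (rel : Q.Arr → Q.Arr → Prop)

/-- A word is allowed (is a basis path of `A = kQ/I`) if consecutive arrows are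
composable and no consecutive pair lies in the relation set generating `I`. -/
def AllowedWord (l : List Q.Arr) : Prop :=
  l.Chain' (fun a b => Q.tgt a = Q.src b ∧ ¬ rel a b)

/-- right maximal paths (of positive length) -/
def RightMaxWord (l : List Q.Arr) : Prop :=
  l ≠ [] ∧ AllowedWord rel l ∧ ∀ a : Q.Arr, ¬ AllowedWord rel (l ++ [a])

/-- left maximal paths (of positive length) -/
def LeftMaxWord (l : List Q.Arr) : Prop :=
  l ≠ [] ∧ AllowedWord rel l ∧ ∀ a : Q.Arr, ¬ AllowedWord rel (a :: l)

/-- finite maximal paths -/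
def FiniteMaxWord (l : List Q.Arr) : Prop := RightMaxWord rel l ∧ LeftMaxWord rel l

/-- a word is primitive if it is not a proper power -/
def PrimitiveWord (l : List Q.Arr) : Prop :=
  ∀ (l' : List Q.Arr) (n : ℕ), 2 ≤ n → l ≠ (List.replicate n l').flatten

/-- a primitive cycle `c` with `c² ∉ I`; these represent the infinite maximal paths `c^∞`. -/
def PrimCycleSq (c : List Q.Arr) : Prop :=
  c ≠ [] ∧ AllowedWord rel (c ++ c) ∧ wTgt? c = wSrc? c ∧ PrimitiveWord c

/-- the maximal path `γ_α` containing `α` is infinite -/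
def InfThrough (a : Q.Arr) : Prop := ∃ c, PrimCycleSq rel c ∧ a ∈ c

/-- the maximal path `γ_α` containing `α` is finite -/
def FinThrough (a : Q.Arr) : Prop := ∃ l, FiniteMaxWord rel l ∧ a ∈ l

/-- the rotation of the cycle `c` starting at the arrow `a`; when `a ∈ c` and `c` has no
duplicates this is the primitive cycle `γ_r(a)`. -/
def rotTo (c : List Q.Arr) (a : Q.Arr) : List Q.Arr :=
  c.dropWhile (fun b => b != a) ++ c.takeWhile (fun b => b != a)

/-- the relation set of the Koszul dual `A#`; its allowed words are the forbidden paths of `A`. -/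
def dualRel : Q.Arr → Q.Arr → Prop := fun a b => Q.tgt a = Q.src b ∧ ¬ rel a b

/-- a forbidden path of `A`, i.e. a path of the Koszul dual `A#` -/
def ForbiddenWord (l : List Q.Arr) : Prop := AllowedWord (dualRel rel) l

variable (Q)

/-- The defining conditions (i)-(iv) of a (locally) gentle algebra, in terms of the set of
length-two relations generating the ideal `I`: an algebra satisfying them is gentle if it
is finite dimensional and locally gentle otherwise. -/
structure IsGentleRel : Prop where
  indeg_le : ∀ v : Q.V, indeg Q v ≤ 2
  outdeg_le : ∀ v : Q.V, outdeg Q v ≤ 2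
  rel_comp : ∀ a b : Q.Arr, rel a b → Q.tgt a = Q.src b
  cond_ii : ∀ a b b' : Q.Arr, b ≠ b' → Q.tgt b = Q.src a → Q.tgt b' = Q.src a →
    Xor' (rel b a) (rel b' a)
  cond_iii : ∀ a b b' : Q.Arr, b ≠ b' → Q.tgt a = Q.src b → Q.tgt a = Q.src b' →
    Xor' (rel a b) (rel a b')

/-- `Q` is (as a quiver) the extended Dynkin quiver `Ã_n` (for `n = |Q₀| - 1`):
every vertex has in-degree and out-degree one. -/
def IsAtilde : Prop := ∀ v : Q.V, indeg Q v = 1 ∧ outdeg Q v = 1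

/-- paths of `Q`, including the stationary paths (`w = []`) at each vertex -/
structure Pth where
  s : Q.V
  w : List Q.Arr
  hs : ∀ a ∈ w.head?, Q.src a = s
  hc : Composable Q w

variable {Q}

/-- target of a path -/
def Pth.t (p : Pth Q) : Q.V := wTgtD p.w p.s

/-- length of a path -/
def Pth.len (p : Pth Q) : ℕ := p.w.length

/-- a basis path of `A = kQ/I` -/
def Pth.Allowed (p : Pth Q) : Prop := AllowedWord rel p.w

end LocGentle
namespace LocGentle

variable (k : Type) [Field k] (Q : Quiv) (rel : Q.Arr → Q.Arr → Prop)

/-- The defining relations presenting `A = kQ/I` as a quotient of the free algebra on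
the stationary paths (vertices) and arrows: the path algebra relations together with
the relations `αβ = 0` for the length-two paths `αβ` generating `I`. -/
inductive GARel : FreeAlgebra k (Q.V ⊕ Q.Arr) → FreeAlgebra k (Q.V ⊕ Q.Arr) → Prop
  | idem (v : Q.V) : GARel (FreeAlgebra.ι k (Sum.inl v) * FreeAlgebra.ι k (Sum.inl v))
      (FreeAlgebra.ι k (Sum.inl v))
  | orth (v w : Q.V) : v ≠ w → GARel (FreeAlgebra.ι k (Sum.inl v) * FreeAlgebra.ι k (Sum.inl w)) 0
  | unit : GARel (∑ v : Q.V, FreeAlgebra.ι k (Sum.inl v)) 1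
  | src_mul (a : Q.Arr) : GARel (FreeAlgebra.ι k (Sum.inl (Q.src a)) * FreeAlgebra.ι k (Sum.inr a))
      (FreeAlgebra.ι k (Sum.inr a))
  | mul_tgt (a : Q.Arr) : GARel (FreeAlgebra.ι k (Sum.inr a) * FreeAlgebra.ι k (Sum.inl (Q.tgt a)))
      (FreeAlgebra.ι k (Sum.inr a))
  | src_zero (v : Q.V) (a : Q.Arr) : v ≠ Q.src a →
      GARel (FreeAlgebra.ι k (Sum.inl v) * FreeAlgebra.ι k (Sum.inr a)) 0
  | tgt_zero (v : Q.V) (a : Q.Arr) : v ≠ Q.tgt a →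
      GARel (FreeAlgebra.ι k (Sum.inr a) * FreeAlgebra.ι k (Sum.inl v)) 0
  | rel_zero (a b : Q.Arr) : rel a b →
      GARel (FreeAlgebra.ι k (Sum.inr a) * FreeAlgebra.ι k (Sum.inr b)) 0

/-- The (locally) gentle algebra `A = kQ/I`. -/
abbrev GA := RingQuot (GARel k Q rel)

/-- the image in `A` of the stationary path at `v` -/
def vtx (v : Q.V) : GA k Q rel := RingQuot.mkAlgHom k _ (FreeAlgebra.ι k (Sum.inl v))

/-- the image in `A` of the arrow `a` -/
def arr (a : Q.Arr) : GA k Q rel := RingQuot.mkAlgHom k _ (FreeAlgebra.ι k (Sum.inr a))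

/-- the image in `A` of the word `l` (the product of its arrows) -/
def wordEl (l : List Q.Arr) : GA k Q rel := (l.map (arr k Q rel)).prod

variable {Q}

/-- the image in `A` of a path (a stationary path maps to the corresponding idempotent) -/
def Pth.el (p : Pth Q) : GA k Q rel := vtx k Q rel p.s * wordEl k Q rel p.w

variable (Q)

/-- the `n`-th graded component `A_n` of `A`, spanned by the images of paths of length `n` -/
def deg (n : ℕ) : Submodule k (GA k Q rel) :=
  Submodule.span k {x | ∃ p : Pth Q, p.Allowed rel ∧ p.len = n ∧ x = p.el k rel}

/-- the augmentation ideal `A₊` (as a `k`-submodule), spanned by paths of positive length -/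
def degPlus : Submodule k (GA k Q rel) :=
  Submodule.span k {x | ∃ p : Pth Q, p.Allowed rel ∧ 1 ≤ p.len ∧ x = p.el k rel}

/-- the Hilbert series of `A` (with integer coefficients) -/
def hilb : PowerSeries ℤ :=
  PowerSeries.mk fun n => (Module.finrank k (deg k Q rel n) : ℤ)

/-- the Hilbert series of `A` (with rational coefficients) -/
def hilbQ : PowerSeries ℚ :=
  PowerSeries.mk fun n => (Module.finrank k (deg k Q rel n) : ℚ)

/-- the number `k_n` of finite maximal paths of length at least `n` -/
def numFMP (n : ℕ) : ℕ := {l : List Q.Arr | FiniteMaxWord rel l ∧ n ≤ l.length}.ncard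

/-- the Gelfand-Kirillov dimension of `A`:
`limsup_n log (dim_k A_{≤ n}) / log n`. -/
def GKdim : ℝ :=
  Filter.limsup (fun n : ℕ =>
      Real.log (Module.finrank k ↥(⨆ i ∈ Finset.range (n + 1), deg k Q rel i)) / Real.log n)
    Filter.atTop

/-- the central element `m_γ` attached to the infinite maximal path `γ = c^∞`:
the sum over the arrows `α` of `c` of the primitive cycle `γ_r(α)` starting at `α`. -/
def mEl (c : List Q.Arr) : GA k Q rel := (c.map fun a => wordEl k Q rel (rotTo c a)).sum

/-- evaluation of a polynomial at `x ∈ A`; `polyEval k Q rel p x` is `p(x)`. -/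
def polyEval (p : Polynomial k) (x : GA k Q rel) : GA k Q rel :=
  Polynomial.eval₂ (algebraMap k (GA k Q rel)) x p

end LocGentle
namespace LocGentle

section GKdimension

variable {k : Type} [Field k] {Q : Quiv} {rel : Q.Arr → Q.Arr → Prop}

lemma vtx_mul_self (v : Q.V) : vtx k Q rel v * vtx k Q rel v = vtx k Q rel v := by
  simpa [vtx] using RingQuot.mkAlgHom_rel k (GARel.idem (k := k) (rel := rel) v)

lemma vtx_mul_vtx_of_ne {v w : Q.V} (h : v ≠ w) : vtx k Q rel v * vtx k Q rel w = 0 := by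
  simpa [vtx] using RingQuot.mkAlgHom_rel k (GARel.orth (k := k) (rel := rel) v w h)

lemma sum_vtx : ∑ v : Q.V, vtx k Q rel v = 1 := by
  simpa [vtx] using RingQuot.mkAlgHom_rel k (GARel.unit (k := k) (rel := rel))

lemma vtx_src_mul_arr (a : Q.Arr) : vtx k Q rel (Q.src a) * arr k Q rel a = arr k Q rel a := by
  simpa [vtx, arr] using RingQuot.mkAlgHom_rel k (GARel.src_mul (k := k) (rel := rel) a)

lemma arr_mul_vtx_tgt (a : Q.Arr) : arr k Q rel a * vtx k Q rel (Q.tgt a) = arr k Q rel a := by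
  simpa [vtx, arr] using RingQuot.mkAlgHom_rel k (GARel.mul_tgt (k := k) (rel := rel) a)

lemma vtx_mul_arr_of_ne {v : Q.V} {a : Q.Arr} (h : v ≠ Q.src a) :
    vtx k Q rel v * arr k Q rel a = 0 := by
  simpa [vtx, arr] using RingQuot.mkAlgHom_rel k (GARel.src_zero (k := k) (rel := rel) v a h)

lemma arr_mul_vtx_of_ne {v : Q.V} {a : Q.Arr} (h : v ≠ Q.tgt a) :
    arr k Q rel a * vtx k Q rel v = 0 := by
  simpa [vtx, arr] using RingQuot.mkAlgHom_rel k (GARel.tgt_zero (k := k) (rel := rel) v a h)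

lemma arr_mul_arr_of_rel {a b : Q.Arr} (h : rel a b) : arr k Q rel a * arr k Q rel b = 0 := by
  simpa [arr] using RingQuot.mkAlgHom_rel k (GARel.rel_zero (k := k) (rel := rel) a b h)

lemma arr_mul_arr_of_ne {a b : Q.Arr} (h : Q.tgt a ≠ Q.src b) :
    arr k Q rel a * arr k Q rel b = 0 := by
  rw [← vtx_src_mul_arr b, ← mul_assoc, arr_mul_vtx_of_ne h.symm, zero_mul]

lemma wordEl_append_singleton (l : List Q.Arr) (a : Q.Arr) :
    wordEl k Q rel (l ++ [a]) = wordEl k Q rel l * arr k Q rel a := by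
  simp [wordEl]

/-- A subspace containing the stationary paths and stable under right multiplication by
stationary paths and arrows is the whole algebra. -/
lemma eq_top_of_mul_mem (S : Submodule k (GA k Q rel)) (hv : ∀ v, vtx k Q rel v ∈ S)
    (hmv : ∀ x ∈ S, ∀ v, x * vtx k Q rel v ∈ S) (hma : ∀ x ∈ S, ∀ a, x * arr k Q rel a ∈ S) :
    S = ⊤ := by
  have one_mem : (1 : GA k Q rel) ∈ S := by
    rw [← sum_vtx]
    exact Submodule.sum_mem _ fun v _ => hv v
  have key : ∀ y : FreeAlgebra k (Q.V ⊕ Q.Arr), ∀ x ∈ S,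
      x * RingQuot.mkAlgHom k (GARel k Q rel) y ∈ S := by
    intro y
    induction y using FreeAlgebra.induction with
    | grade0 r =>
      intro x hx
      rw [AlgHom.commutes, ← Algebra.commutes, ← Algebra.smul_def]
      exact S.smul_mem r hx
    | grade1 g =>
      intro x hx
      rcases g with v | a
      · exact hmv x hx v
      · exact hma x hx a
    | mul y z hy hz =>
      intro x hx
      rw [map_mul, ← mul_assoc]
      exact hz _ (hy x hx)
    | add y z hy hz =>
      intro x hx
      rw [map_add, mul_add]
      exact S.add_mem (hy x hx) (hz x hx)
  refine Submodule.eq_top_iff'.2 fun x => ?_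
  obtain ⟨y, rfl⟩ := RingQuot.mkAlgHom_surjective k (GARel k Q rel) x
  simpa using key y 1 one_mem

lemma Pth.el_mul_vtx (p : Pth Q) (v : Q.V) :
    p.el k rel * vtx k Q rel v = 0 ∨ p.el k rel * vtx k Q rel v = p.el k rel := by
  obtain ⟨s, w, hs, hc⟩ := p
  rcases List.eq_nil_or_concat' w with rfl | ⟨w, b, rfl⟩
  · by_cases h : s = v
    · subst h
      simp [Pth.el, wordEl, vtx_mul_self]
    · simp [Pth.el, wordEl, vtx_mul_vtx_of_ne h]
  · by_cases h : v = Q.tgt b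
    · subst h
      simp [Pth.el, wordEl_append_singleton, mul_assoc, arr_mul_vtx_tgt]
    · simp [Pth.el, wordEl_append_singleton, mul_assoc, arr_mul_vtx_of_ne h]

lemma Pth.el_mul_arr (p : Pth Q) (hp : p.Allowed rel) (a : Q.Arr) :
    p.el k rel * arr k Q rel a = 0 ∨
      ∃ q : Pth Q, q.Allowed rel ∧ q.len = p.len + 1 ∧ p.el k rel * arr k Q rel a = q.el k rel := by
  obtain ⟨s, w, hs, hc⟩ := p
  rcases List.eq_nil_or_concat' w with rfl | ⟨w, b, rfl⟩
  · by_cases h : s = Q.src a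
    · right
      refine ⟨⟨s, [a], by simp [h], List.isChain_singleton a⟩, List.isChain_singleton a,
        by simp [Pth.len], by simp [Pth.el, wordEl]⟩
    · left
      simp [Pth.el, wordEl, vtx_mul_arr_of_ne h]
  · by_cases h : Q.tgt b = Q.src a ∧ ¬ rel b a
    · right
      refine ⟨⟨s, w ++ [b] ++ [a], by simpa using hs, ?_⟩, ?_, by simp [Pth.len], ?_⟩
      · refine List.isChain_append.2 ⟨hc, by simp, by simpa using h.1⟩
      · refine List.isChain_append.2 ⟨hp, by simp, by simpa using h⟩
      · simp [Pth.el, wordEl, mul_assoc]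
    · left
      have h0 : arr k Q rel b * arr k Q rel a = 0 := by
        by_cases h1 : Q.tgt b = Q.src a
        · exact arr_mul_arr_of_rel (by tauto)
        · exact arr_mul_arr_of_ne h1
      simp [Pth.el, wordEl_append_singleton, mul_assoc, h0]

variable (k Q rel) in
/-- The span `A_{≤ n}` of the paths of length at most `n`. -/
abbrev degLE (n : ℕ) : Submodule k (GA k Q rel) := ⨆ i ∈ Finset.range (n + 1), deg k Q rel i

lemma deg_le_degLE {i n : ℕ} (h : i ≤ n) : deg k Q rel i ≤ degLE k Q rel n :=
  le_iSup₂_of_le i (Finset.mem_range.2 (by omega)) le_rfl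

lemma degLE_zero : degLE k Q rel 0 = deg k Q rel 0 := by
  simp [degLE]

lemma degLE_succ (n : ℕ) : degLE k Q rel (n + 1) = degLE k Q rel n ⊔ deg k Q rel (n + 1) := by
  rw [degLE, Finset.range_add_one, Finset.iSup_insert, sup_comm]

lemma Pth.el_mem_deg {p : Pth Q} (hp : p.Allowed rel) : p.el k rel ∈ deg k Q rel p.len :=
  Submodule.subset_span ⟨p, hp, rfl, rfl⟩

lemma vtx_mem_deg_zero (v : Q.V) : vtx k Q rel v ∈ deg k Q rel 0 :=
  Submodule.subset_span ⟨⟨v, [], by simp, List.isChain_nil⟩,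
    List.isChain_nil, rfl, by simp [Pth.el, wordEl]⟩

/-- A linear endomorphism sends `A_{≤ n}` into `S` as soon as it does so on paths. -/
lemma map_mem_of_mem_degLE (f : GA k Q rel →ₗ[k] GA k Q rel) {n : ℕ}
    {S : Submodule k (GA k Q rel)}
    (h : ∀ p : Pth Q, p.Allowed rel → p.len ≤ n → f (p.el k rel) ∈ S)
    {x : GA k Q rel} (hx : x ∈ degLE k Q rel n) : f x ∈ S := by
  have hle : degLE k Q rel n ≤ S.comap f := by
    refine iSup₂_le fun i hi => Submodule.span_le.2 ?_
    rintro _ ⟨p, hp, rfl, rfl⟩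
    exact h p hp (by simpa [Nat.lt_succ_iff] using hi)
  exact hle hx

lemma degLE_mul_vtx {n : ℕ} {x : GA k Q rel} (hx : x ∈ degLE k Q rel n) (v : Q.V) :
    x * vtx k Q rel v ∈ degLE k Q rel n := by
  refine map_mem_of_mem_degLE (LinearMap.mulRight k (vtx k Q rel v)) (fun p hp hn => ?_) hx
  rw [LinearMap.mulRight_apply]
  rcases p.el_mul_vtx (k := k) (rel := rel) v with h | h <;> rw [h]
  · exact Submodule.zero_mem _
  · exact deg_le_degLE hn (Pth.el_mem_deg hp)

lemma degLE_mul_arr {n : ℕ} {x : GA k Q rel} (hx : x ∈ degLE k Q rel n) (a : Q.Arr) :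
    x * arr k Q rel a ∈ degLE k Q rel (n + 1) := by
  refine map_mem_of_mem_degLE (LinearMap.mulRight k (arr k Q rel a)) (fun p hp hn => ?_) hx
  rw [LinearMap.mulRight_apply]
  rcases p.el_mul_arr (k := k) hp a with h | ⟨q, hq, hlen, h⟩ <;> rw [h]
  · exact Submodule.zero_mem _
  · exact deg_le_degLE (by omega) (Pth.el_mem_deg hq)

lemma degLE_eq_top_of_succ_eq {n : ℕ} (h : degLE k Q rel (n + 1) = degLE k Q rel n) :
    degLE k Q rel n = ⊤ :=
  eq_top_of_mul_mem _ (fun v => deg_le_degLE n.zero_le (vtx_mem_deg_zero v))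
    (fun _ hx v => degLE_mul_vtx hx v) (fun _ hx a => h ▸ degLE_mul_arr hx a)

/-- In a (locally) gentle algebra an arrow has at most one nonzero continuation. -/
lemma IsGentleRel.next_unique (hg : IsGentleRel Q rel) {a b b' : Q.Arr}
    (hb : Q.tgt a = Q.src b ∧ ¬ rel a b) (hb' : Q.tgt a = Q.src b' ∧ ¬ rel a b') : b = b' := by
  by_contra hne
  rcases hg.cond_iii a b b' hne hb.1 hb'.1 with h | h
  · exact hb.2 h.1
  · exact hb'.2 h.1

lemma IsGentleRel.allowedWord_unique (hg : IsGentleRel Q rel) (l : List Q.Arr) :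
    ∀ (a : Q.Arr) (l' : List Q.Arr), AllowedWord rel (a :: l) → AllowedWord rel (a :: l') →
      l.length = l'.length → l = l' := by
  induction l with
  | nil =>
    intro a l' _ _ h
    exact (List.length_eq_zero_iff.1 h.symm).symm
  | cons b l ih =>
    intro a l' hl hl' h
    cases l' with
    | nil => simp at h
    | cons b' l' =>
      obtain ⟨h1, h2⟩ := List.isChain_cons_cons.1 hl
      obtain ⟨h1', h2'⟩ := List.isChain_cons_cons.1 hl'
      obtain rfl := hg.next_unique h1 h1'
      rw [ih b l' h2 h2' (by simpa using h)]

/-- The first arrow of a path, or its base vertex when the path is stationary. -/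
def Pth.start (p : Pth Q) : Q.V ⊕ Q.Arr :=
  match p.w with
  | [] => Sum.inl p.s
  | a :: _ => Sum.inr a

lemma IsGentleRel.start_injective (hg : IsGentleRel Q rel) (n : ℕ) :
    Function.Injective fun p : {p : Pth Q // p.Allowed rel ∧ p.len = n} => p.1.start := by
  rintro ⟨⟨s, w, hs, hc⟩, hp, hn⟩ ⟨⟨s', w', hs', hc'⟩, hp', hn'⟩ h
  have hlen : w.length = w'.length := hn.trans hn'.symm
  cases w with
  | nil =>
    cases w' with
    | nil =>
      obtain rfl : s = s' := Sum.inl.inj h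
      rfl
    | cons a' w' => simp at hlen
  | cons a w =>
    cases w' with
    | nil => simp at hlen
    | cons a' w' =>
      obtain rfl : a = a' := Sum.inr.inj h
      obtain rfl := hg.allowedWord_unique w a w' hp hp' (by simpa using hlen)
      obtain rfl : Q.src a = s := hs a rfl
      obtain rfl : Q.src a = s' := hs' a rfl
      rfl

lemma deg_eq_span_range (n : ℕ) : deg k Q rel n = Submodule.span k
    (Set.range fun p : {p : Pth Q // p.Allowed rel ∧ p.len = n} => p.1.el k rel) := by
  rw [deg]
  congr 1
  ext x
  constructor
  · rintro ⟨p, hp, hn, rfl⟩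
    exact ⟨⟨p, hp, hn⟩, rfl⟩
  · rintro ⟨⟨p, hp, hn⟩, rfl⟩
    exact ⟨p, hp, hn, rfl⟩

lemma IsGentleRel.finiteDimensional_deg (hg : IsGentleRel Q rel) (n : ℕ) :
    FiniteDimensional k (deg k Q rel n) := by
  have := Finite.of_injective _ (hg.start_injective n)
  rw [deg_eq_span_range]
  exact FiniteDimensional.span_of_finite k (Set.finite_range _)

lemma IsGentleRel.finrank_deg_le (hg : IsGentleRel Q rel) (n : ℕ) :
    Module.finrank k (deg k Q rel n) ≤ Fintype.card (Q.V ⊕ Q.Arr) := by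
  have := Fintype.ofInjective _ (hg.start_injective n)
  rw [deg_eq_span_range]
  exact (finrank_range_le_card _).trans (Fintype.card_le_of_injective _ (hg.start_injective n))

lemma IsGentleRel.finiteDimensional_degLE (hg : IsGentleRel Q rel) (n : ℕ) :
    FiniteDimensional k (degLE k Q rel n) := by
  have := hg.finiteDimensional_deg (k := k)
  induction n with
  | zero => rw [degLE_zero]; infer_instance
  | succ n ih => rw [degLE_succ]; infer_instance

lemma IsGentleRel.finrank_degLE_le (hg : IsGentleRel Q rel) (n : ℕ) :
    Module.finrank k (degLE k Q rel n) ≤ (n + 1) * Fintype.card (Q.V ⊕ Q.Arr) := by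
  have := hg.finiteDimensional_deg (k := k)
  induction n with
  | zero => rw [degLE_zero, zero_add, one_mul]; exact hg.finrank_deg_le 0
  | succ n ih =>
    have := hg.finiteDimensional_degLE (k := k) n
    rw [degLE_succ, add_mul _ 1, one_mul]
    exact (Submodule.finrank_add_le_finrank_add_finrank _ _).trans
      (Nat.add_le_add ih (hg.finrank_deg_le _))

lemma IsGentleRel.le_finrank_degLE (hg : IsGentleRel Q rel)
    (hinf : ¬ FiniteDimensional k (GA k Q rel)) (n : ℕ) :
    n ≤ Module.finrank k (degLE k Q rel n) := by
  induction n with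
  | zero => exact Nat.zero_le _
  | succ n ih =>
    have := hg.finiteDimensional_degLE (k := k)
    have hlt : degLE k Q rel n < degLE k Q rel (n + 1) := by
      refine lt_of_le_of_ne (by rw [degLE_succ]; exact le_sup_left) fun h => hinf ?_
      have htop := degLE_eq_top_of_succ_eq h.symm
      have hfin := this n
      rw [htop] at hfin
      exact Module.finite_def.2 (Module.Finite.iff_fg.1 hfin)
    exact ih.trans_lt (Submodule.finrank_lt_finrank_of_lt hlt)

open Filter Topology

lemma tendsto_log_natCast_atTop : Tendsto (fun n : ℕ => Real.log n) atTop atTop :=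
  Real.tendsto_log_atTop.comp tendsto_natCast_atTop_atTop

lemma tendsto_log_div_log_of_bounded {f : ℕ → ℕ} {C : ℕ} (hf : ∀ n, f n ≤ C) :
    Tendsto (fun n => Real.log (f n) / Real.log n) atTop (𝓝 0) := by
  refine tendsto_log_natCast_atTop.const_div_atTop (Real.log C) |> squeeze_zero
    (fun n => by positivity) fun n => ?_
  rcases Nat.eq_zero_or_pos (f n) with h | h
  · rw [h, Nat.cast_zero, Real.log_zero, zero_div]
    positivity
  · gcongr
    exact hf n

lemma tendsto_log_div_log_of_linear {f : ℕ → ℕ} {C : ℕ} (hl : ∀ n, n ≤ f n)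
    (hu : ∀ n, f n ≤ (n + 1) * C) :
    Tendsto (fun n => Real.log (f n) / Real.log n) atTop (𝓝 1) := by
  have hlim : Tendsto (fun n : ℕ => 1 + Real.log (2 * C : ℕ) / Real.log n) atTop (𝓝 1) := by
    simpa using (tendsto_log_natCast_atTop.const_div_atTop (Real.log (2 * C : ℕ))).const_add 1
  refine tendsto_of_tendsto_of_tendsto_of_le_of_le' tendsto_const_nhds hlim ?_ ?_
  all_goals
    filter_upwards [eventually_ge_atTop 2] with n hn
    have hn0 : (0 : ℝ) < n := by exact_mod_cast (by omega : 0 < n)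
    have hlog : 0 < Real.log n := Real.log_pos (by exact_mod_cast hn)
  · rw [one_le_div hlog]
    exact Real.log_le_log hn0 (by exact_mod_cast hl n)
  · have hC : C ≠ 0 := by
      rintro rfl
      have := (hl n).trans (hu n)
      omega
    rw [div_le_iff₀ hlog, add_mul, one_mul, div_mul_cancel₀ _ hlog.ne',
      ← Real.log_mul hn0.ne' (by exact_mod_cast mul_ne_zero two_ne_zero hC)]
    refine Real.log_le_log (by exact_mod_cast (by omega : 0 < n).trans_le (hl n)) ?_
    exact_mod_cast (hu n).trans (by nlinarith)

end GKdimension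

/-- **Lemma 6.4 (lem:GKdim).** Let `A = kQ/I` be a (locally) gentle algebra.  Then
`GKdim A = 1` if `A` is locally gentle (infinite dimensional) and `GKdim A = 0` if `A` is
gentle (finite dimensional). -/
theorem statement17 (k : Type) [Field k] [CharZero k] (Q : Quiv)
    (rel : Q.Arr → Q.Arr → Prop) (hgentle : IsGentleRel Q rel) :
    (¬ FiniteDimensional k (GA k Q rel) → GKdim k Q rel = 1) ∧
    (FiniteDimensional k (GA k Q rel) → GKdim k Q rel = 0) := by
  refine ⟨fun hinf => ?_, fun hfin => ?_⟩
  · exact (tendsto_log_div_log_of_linear (hgentle.le_finrank_degLE hinf)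
      hgentle.finrank_degLE_le).limsup_eq
  · exact (tendsto_log_div_log_of_bounded
      fun n => Submodule.finrank_le (degLE k Q rel n)).limsup_eq

end LocGentle
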